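/- If the block TBT-matrix T is invertible, then R A_p − A_p^* R = i Γ_p Γ̂_p for p = 1,2, where R = T^{−1}. -/

import Mathlib

open Matrix Kronecker BigOperators

noncomputable section

namespace TBT

/-- The entries `a_r` of the matrices `𝒜_p`. -/
def aEnt (r : ℤ) : ℂ := if r < 0 then 0 else if r = 0 then Complex.I / 2 else Complex.I

/-- The `n × n` matrix `𝒜 = {a_{j-ℓ}}`. -/
def calA (n : ℕ) : Matrix (Fin n) (Fin n) ℂ :=
  Matrix.of fun j ℓ => aEnt (((j : ℕ) : ℤ) - ((ℓ : ℕ) : ℤ))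

/-- The index type of the `m × m` matrices, `m = m₁ m₂ m₃`. -/
abbrev Idx (m₁ m₂ m₃ : ℕ) := (Fin m₁ × Fin m₂) × Fin m₃

/-- `A₁ = 𝒜₁ ⊗ I_{m₂} ⊗ I_{m₃}`. -/
def A1 (m₁ m₂ m₃ : ℕ) : Matrix (Idx m₁ m₂ m₃) (Idx m₁ m₂ m₃) ℂ :=
  (calA m₁ ⊗ₖ (1 : Matrix (Fin m₂) (Fin m₂) ℂ)) ⊗ₖ (1 : Matrix (Fin m₃) (Fin m₃) ℂ)

/-- `A₂ = I_{m₁} ⊗ 𝒜₂ ⊗ I_{m₃}`. -/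
def A2 (m₁ m₂ m₃ : ℕ) : Matrix (Idx m₁ m₂ m₃) (Idx m₁ m₂ m₃) ℂ :=
  ((1 : Matrix (Fin m₁) (Fin m₁) ℂ) ⊗ₖ calA m₂) ⊗ₖ (1 : Matrix (Fin m₃) (Fin m₃) ℂ)

/-- `A₃ = I_{m₁} ⊗ I_{m₂} ⊗ 𝒜₃`. -/
def A3 (m₁ m₂ m₃ : ℕ) : Matrix (Idx m₁ m₂ m₃) (Idx m₁ m₂ m₃) ℂ :=
  ((1 : Matrix (Fin m₁) (Fin m₁) ℂ) ⊗ₖ (1 : Matrix (Fin m₂) (Fin m₂) ℂ)) ⊗ₖ calA m₃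

/-- The block TBT-matrix `T = {𝒯_{i-k}}`, `𝒯_r = {t^{(r)}_{i-k}}`, built from the
data `t : ℤ → ℤ → Matrix (Fin m₃) (Fin m₃) ℂ` of its `m₃ × m₃` blocks. -/
def Tmat (m₁ m₂ m₃ : ℕ) (t : ℤ → ℤ → Matrix (Fin m₃) (Fin m₃) ℂ) :
    Matrix (Idx m₁ m₂ m₃) (Idx m₁ m₂ m₃) ℂ :=
  Matrix.of fun x y =>
    t (((x.1.1 : ℕ) : ℤ) - ((y.1.1 : ℕ) : ℤ)) (((x.1.2 : ℕ) : ℤ) - ((y.1.2 : ℕ) : ℤ)) x.2 y.2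

/-- The Toeplitz blocks `𝒯_r = {t^{(r)}_{i-k}}` of a block TBT-matrix. -/
def calT (m₂ m₃ : ℕ) (t : ℤ → ℤ → Matrix (Fin m₃) (Fin m₃) ℂ) (r : ℤ) :
    Matrix (Fin m₂ × Fin m₃) (Fin m₂ × Fin m₃) ℂ :=
  Matrix.of fun x y => t r (((x.1 : ℕ) : ℤ) - ((y.1 : ℕ) : ℤ)) x.2 y.2

/-- `M₁₁ = col [M₁₁⁽¹⁾ … M₁₁⁽ᵐ¹⁾]`, `M₁₁⁽ⁱ⁾ = (1/2)𝒯₀ + Σ_{s=1}^{i-1} 𝒯_s`. -/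
def M11 (m₁ m₂ m₃ : ℕ) (t : ℤ → ℤ → Matrix (Fin m₃) (Fin m₃) ℂ) :
    Matrix (Idx m₁ m₂ m₃) (Fin m₂ × Fin m₃) ℂ :=
  Matrix.of fun x y =>
    ((2 : ℂ)⁻¹ • calT m₂ m₃ t 0 +
      ∑ s ∈ Finset.range (x.1.1 : ℕ), calT m₂ m₃ t ((s : ℤ) + 1)) (x.1.2, x.2) y

/-- `M₂₁ = 1_{m₁}^* ⊗ I_{m₂ m₃}`. -/
def M21 (m₁ m₂ m₃ : ℕ) : Matrix (Fin m₂ × Fin m₃) (Idx m₁ m₂ m₃) ℂ :=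
  Matrix.of fun y x => if y.1 = x.1.2 ∧ y.2 = x.2 then 1 else 0

/-- `M₃₁ = M₂₁^*`. -/
def M31 (m₁ m₂ m₃ : ℕ) : Matrix (Idx m₁ m₂ m₃) (Fin m₂ × Fin m₃) ℂ := (M21 m₁ m₂ m₃)ᴴ

/-- `M₄₁ = [M₄₁⁽¹⁾ … M₄₁⁽ᵐ¹⁾]`, `M₄₁⁽ᵏ⁾ = (1/2)𝒯₀ + Σ_{s=1}^{k-1} 𝒯_{-s}`. -/
def M41 (m₁ m₂ m₃ : ℕ) (t : ℤ → ℤ → Matrix (Fin m₃) (Fin m₃) ℂ) :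
    Matrix (Fin m₂ × Fin m₃) (Idx m₁ m₂ m₃) ℂ :=
  Matrix.of fun y x =>
    ((2 : ℂ)⁻¹ • calT m₂ m₃ t 0 +
      ∑ s ∈ Finset.range (x.1.1 : ℕ), calT m₂ m₃ t (-((s : ℤ) + 1))) y (x.1.2, x.2)

/-- The blocks `M₁₂⁽ʳ⁾ = col [(1/2)t₀⁽ʳ⁾, (1/2)t₀⁽ʳ⁾ + t₁⁽ʳ⁾, …]`. -/
def M12blk (m₂ m₃ : ℕ) (t : ℤ → ℤ → Matrix (Fin m₃) (Fin m₃) ℂ) (r : ℤ) :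
    Matrix (Fin m₂ × Fin m₃) (Fin m₃) ℂ :=
  Matrix.of fun x l =>
    ((2 : ℂ)⁻¹ • t r 0 + ∑ j ∈ Finset.range (x.1 : ℕ), t r ((j : ℤ) + 1)) x.2 l

/-- `M₁₂ = {M₁₂^{(i-k)}}_{i,k=1}^{m₁}`. -/
def M12 (m₁ m₂ m₃ : ℕ) (t : ℤ → ℤ → Matrix (Fin m₃) (Fin m₃) ℂ) :
    Matrix (Idx m₁ m₂ m₃) (Fin m₁ × Fin m₃) ℂ :=
  Matrix.of fun x y => M12blk m₂ m₃ t (((x.1.1 : ℕ) : ℤ) - ((y.1 : ℕ) : ℤ)) (x.1.2, x.2) y.2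

/-- `M₂₂ = I_{m₁} ⊗ 1_{m₂}^* ⊗ I_{m₃}`. -/
def M22 (m₁ m₂ m₃ : ℕ) : Matrix (Fin m₁ × Fin m₃) (Idx m₁ m₂ m₃) ℂ :=
  Matrix.of fun y x => if y.1 = x.1.1 ∧ y.2 = x.2 then 1 else 0

/-- `M₃₂ = M₂₂^*`. -/
def M32 (m₁ m₂ m₃ : ℕ) : Matrix (Idx m₁ m₂ m₃) (Fin m₁ × Fin m₃) ℂ := (M22 m₁ m₂ m₃)ᴴ

/-- The blocks `M₄₂⁽ʳ⁾ = [(1/2)t₀⁽ʳ⁾, (1/2)t₀⁽ʳ⁾ + t₋₁⁽ʳ⁾, …]`. -/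
def M42blk (m₂ m₃ : ℕ) (t : ℤ → ℤ → Matrix (Fin m₃) (Fin m₃) ℂ) (r : ℤ) :
    Matrix (Fin m₃) (Fin m₂ × Fin m₃) ℂ :=
  Matrix.of fun l x =>
    ((2 : ℂ)⁻¹ • t r 0 + ∑ j ∈ Finset.range (x.1 : ℕ), t r (-((j : ℤ) + 1))) l x.2

/-- `M₄₂ = {M₄₂^{(i-k)}}_{i,k=1}^{m₁}`. -/
def M42 (m₁ m₂ m₃ : ℕ) (t : ℤ → ℤ → Matrix (Fin m₃) (Fin m₃) ℂ) :
    Matrix (Fin m₁ × Fin m₃) (Idx m₁ m₂ m₃) ℂ :=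
  Matrix.of fun y x => M42blk m₂ m₃ t (((y.1 : ℕ) : ℤ) - ((x.1.1 : ℕ) : ℤ)) y.2 (x.1.2, x.2)

/-- `Π₁ = [M₁₁ M₃₁]`. -/
def Pi1 (m₁ m₂ m₃ : ℕ) (t : ℤ → ℤ → Matrix (Fin m₃) (Fin m₃) ℂ) :
    Matrix (Idx m₁ m₂ m₃) ((Fin m₂ × Fin m₃) ⊕ (Fin m₂ × Fin m₃)) ℂ :=
  Matrix.fromCols (M11 m₁ m₂ m₃ t) (M31 m₁ m₂ m₃)

/-- `Π₂ = [M₁₂ M₃₂]`. -/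
def Pi2 (m₁ m₂ m₃ : ℕ) (t : ℤ → ℤ → Matrix (Fin m₃) (Fin m₃) ℂ) :
    Matrix (Idx m₁ m₂ m₃) ((Fin m₁ × Fin m₃) ⊕ (Fin m₁ × Fin m₃)) ℂ :=
  Matrix.fromCols (M12 m₁ m₂ m₃ t) (M32 m₁ m₂ m₃)

/-- `Π̂₁ = col [M₂₁; M₄₁]`. -/
def Pihat1 (m₁ m₂ m₃ : ℕ) (t : ℤ → ℤ → Matrix (Fin m₃) (Fin m₃) ℂ) :
    Matrix ((Fin m₂ × Fin m₃) ⊕ (Fin m₂ × Fin m₃)) (Idx m₁ m₂ m₃) ℂ :=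
  Matrix.fromRows (M21 m₁ m₂ m₃) (M41 m₁ m₂ m₃ t)

/-- `Π̂₂ = col [M₂₂; M₄₂]`. -/
def Pihat2 (m₁ m₂ m₃ : ℕ) (t : ℤ → ℤ → Matrix (Fin m₃) (Fin m₃) ℂ) :
    Matrix ((Fin m₁ × Fin m₃) ⊕ (Fin m₁ × Fin m₃)) (Idx m₁ m₂ m₃) ℂ :=
  Matrix.fromRows (M22 m₁ m₂ m₃) (M42 m₁ m₂ m₃ t)

/-- `Γ₁ = T⁻¹ Π₁`. -/
def Gamma1 (m₁ m₂ m₃ : ℕ) (t : ℤ → ℤ → Matrix (Fin m₃) (Fin m₃) ℂ) :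
    Matrix (Idx m₁ m₂ m₃) ((Fin m₂ × Fin m₃) ⊕ (Fin m₂ × Fin m₃)) ℂ :=
  (Tmat m₁ m₂ m₃ t)⁻¹ * Pi1 m₁ m₂ m₃ t

/-- `Γ₂ = T⁻¹ Π₂`. -/
def Gamma2 (m₁ m₂ m₃ : ℕ) (t : ℤ → ℤ → Matrix (Fin m₃) (Fin m₃) ℂ) :
    Matrix (Idx m₁ m₂ m₃) ((Fin m₁ × Fin m₃) ⊕ (Fin m₁ × Fin m₃)) ℂ :=
  (Tmat m₁ m₂ m₃ t)⁻¹ * Pi2 m₁ m₂ m₃ t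

/-- `Γ̂₁ = Π̂₁ T⁻¹`. -/
def Gammahat1 (m₁ m₂ m₃ : ℕ) (t : ℤ → ℤ → Matrix (Fin m₃) (Fin m₃) ℂ) :
    Matrix ((Fin m₂ × Fin m₃) ⊕ (Fin m₂ × Fin m₃)) (Idx m₁ m₂ m₃) ℂ :=
  Pihat1 m₁ m₂ m₃ t * (Tmat m₁ m₂ m₃ t)⁻¹

/-- `Γ̂₂ = Π̂₂ T⁻¹`. -/
def Gammahat2 (m₁ m₂ m₃ : ℕ) (t : ℤ → ℤ → Matrix (Fin m₃) (Fin m₃) ℂ) :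
    Matrix ((Fin m₁ × Fin m₃) ⊕ (Fin m₁ × Fin m₃)) (Idx m₁ m₂ m₃) ℂ :=
  Pihat2 m₁ m₂ m₃ t * (Tmat m₁ m₂ m₃ t)⁻¹

/-- `ℒ = 1_{m₁m₂} ⊗ I_{m₃}`. -/
def Lmat (m₁ m₂ m₃ : ℕ) : Matrix (Idx m₁ m₂ m₃) (Fin m₃) ℂ :=
  Matrix.of fun x l => if x.2 = l then 1 else 0

/-- `ℒ_p = 1_{m_p} ⊗ I_{m₃}`. -/
def Lp (n m₃ : ℕ) : Matrix (Fin n × Fin m₃) (Fin m₃) ℂ :=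
  Matrix.of fun x l => if x.2 = l then 1 else 0

/-- A row vector `v` Kronecker the identity `I_{m₃}`. -/
def rowKronId {n : Type*} (m₃ : ℕ) (v : n → ℂ) : Matrix (Fin m₃) (n × Fin m₃) ℂ :=
  Matrix.of fun l x => v x.1 * (if l = x.2 then 1 else 0)

/-- A column vector `v` Kronecker the identity `I_{m₃}`. -/
def colKronId {n : Type*} (m₃ : ℕ) (v : n → ℂ) : Matrix (n × Fin m₃) (Fin m₃) ℂ :=
  Matrix.of fun x l => v x.1 * (if x.2 = l then 1 else 0)

/-- `ω(λ,μ) = ℒ^* (A₁^*-μ₁I)⁻¹ (A₂^*-μ₂I)⁻¹ T⁻¹ (A₁-λ₁I)⁻¹ (A₂-λ₂I)⁻¹ ℒ`. -/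
def omegaF (m₁ m₂ m₃ : ℕ) (t : ℤ → ℤ → Matrix (Fin m₃) (Fin m₃) ℂ) (l₁ l₂ mu₁ mu₂ : ℂ) :
    Matrix (Fin m₃) (Fin m₃) ℂ :=
  (Lmat m₁ m₂ m₃)ᴴ * ((A1 m₁ m₂ m₃)ᴴ - mu₁ • 1)⁻¹ * ((A2 m₁ m₂ m₃)ᴴ - mu₂ • 1)⁻¹ *
    (Tmat m₁ m₂ m₃ t)⁻¹ * (A1 m₁ m₂ m₃ - l₁ • 1)⁻¹ * (A2 m₁ m₂ m₃ - l₂ • 1)⁻¹ *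
    Lmat m₁ m₂ m₃

/-- `v₁(μ) = ℒ^* (A₁^*-μ₁I)⁻¹ (A₂^*-μ₂I)⁻¹ Γ₁`. -/
def v1 (m₁ m₂ m₃ : ℕ) (t : ℤ → ℤ → Matrix (Fin m₃) (Fin m₃) ℂ) (mu₁ mu₂ : ℂ) :
    Matrix (Fin m₃) ((Fin m₂ × Fin m₃) ⊕ (Fin m₂ × Fin m₃)) ℂ :=
  (Lmat m₁ m₂ m₃)ᴴ * ((A1 m₁ m₂ m₃)ᴴ - mu₁ • 1)⁻¹ * ((A2 m₁ m₂ m₃)ᴴ - mu₂ • 1)⁻¹ *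
    Gamma1 m₁ m₂ m₃ t

/-- `v₂(μ) = ℒ^* (A₁^*-μ₁I)⁻¹ (A₂^*-μ₂I)⁻¹ Γ₂`. -/
def v2 (m₁ m₂ m₃ : ℕ) (t : ℤ → ℤ → Matrix (Fin m₃) (Fin m₃) ℂ) (mu₁ mu₂ : ℂ) :
    Matrix (Fin m₃) ((Fin m₁ × Fin m₃) ⊕ (Fin m₁ × Fin m₃)) ℂ :=
  (Lmat m₁ m₂ m₃)ᴴ * ((A1 m₁ m₂ m₃)ᴴ - mu₁ • 1)⁻¹ * ((A2 m₁ m₂ m₃)ᴴ - mu₂ • 1)⁻¹ *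
    Gamma2 m₁ m₂ m₃ t

/-- `v̂₁(λ) = Γ̂₁ (A₁-λ₁I)⁻¹ (A₂-λ₂I)⁻¹ ℒ`. -/
def vhat1 (m₁ m₂ m₃ : ℕ) (t : ℤ → ℤ → Matrix (Fin m₃) (Fin m₃) ℂ) (l₁ l₂ : ℂ) :
    Matrix ((Fin m₂ × Fin m₃) ⊕ (Fin m₂ × Fin m₃)) (Fin m₃) ℂ :=
  Gammahat1 m₁ m₂ m₃ t * (A1 m₁ m₂ m₃ - l₁ • 1)⁻¹ * (A2 m₁ m₂ m₃ - l₂ • 1)⁻¹ * Lmat m₁ m₂ m₃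

/-- `v̂₂(λ) = Γ̂₂ (A₁-λ₁I)⁻¹ (A₂-λ₂I)⁻¹ ℒ`. -/
def vhat2 (m₁ m₂ m₃ : ℕ) (t : ℤ → ℤ → Matrix (Fin m₃) (Fin m₃) ℂ) (l₁ l₂ : ℂ) :
    Matrix ((Fin m₁ × Fin m₃) ⊕ (Fin m₁ × Fin m₃)) (Fin m₃) ℂ :=
  Gammahat2 m₁ m₂ m₃ t * (A1 m₁ m₂ m₃ - l₁ • 1)⁻¹ * (A2 m₁ m₂ m₃ - l₂ • 1)⁻¹ * Lmat m₁ m₂ m₃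

/-- `u₁(μ) = v₁(μ) - i (1_{m₂}^* (𝒜₂^*-μ₂I)⁻¹ ⊗ I_{m₃}) [I_{m₂m₃} 0]`. -/
def u1 (m₁ m₂ m₃ : ℕ) (t : ℤ → ℤ → Matrix (Fin m₃) (Fin m₃) ℂ) (mu₁ mu₂ : ℂ) :
    Matrix (Fin m₃) ((Fin m₂ × Fin m₃) ⊕ (Fin m₂ × Fin m₃)) ℂ :=
  v1 m₁ m₂ m₃ t mu₁ mu₂ -
    Complex.I • Matrix.fromCols
      (rowKronId m₃ (Matrix.vecMul (fun _ : Fin m₂ => (1 : ℂ)) (((calA m₂)ᴴ - mu₂ • 1)⁻¹))) 0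

/-- `u₂(μ) = v₂(μ) - i (1_{m₁}^* (𝒜₁^*-μ₁I)⁻¹ ⊗ I_{m₃}) [I_{m₁m₃} 0]`. -/
def u2 (m₁ m₂ m₃ : ℕ) (t : ℤ → ℤ → Matrix (Fin m₃) (Fin m₃) ℂ) (mu₁ mu₂ : ℂ) :
    Matrix (Fin m₃) ((Fin m₁ × Fin m₃) ⊕ (Fin m₁ × Fin m₃)) ℂ :=
  v2 m₁ m₂ m₃ t mu₁ mu₂ -
    Complex.I • Matrix.fromCols
      (rowKronId m₃ (Matrix.vecMul (fun _ : Fin m₁ => (1 : ℂ)) (((calA m₁)ᴴ - mu₁ • 1)⁻¹))) 0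

/-- `û₁(λ) = v̂₁(λ) + i col[0; I_{m₂m₃}] ((𝒜₂-λ₂I)⁻¹ 1_{m₂} ⊗ I_{m₃})`. -/
def uhat1 (m₁ m₂ m₃ : ℕ) (t : ℤ → ℤ → Matrix (Fin m₃) (Fin m₃) ℂ) (l₁ l₂ : ℂ) :
    Matrix ((Fin m₂ × Fin m₃) ⊕ (Fin m₂ × Fin m₃)) (Fin m₃) ℂ :=
  vhat1 m₁ m₂ m₃ t l₁ l₂ +
    Complex.I • Matrix.fromRows 0
      (colKronId m₃ (Matrix.mulVec ((calA m₂ - l₂ • 1)⁻¹) (fun _ : Fin m₂ => (1 : ℂ))))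

/-- `û₂(λ) = v̂₂(λ) + i col[0; I_{m₁m₃}] ((𝒜₁-λ₁I)⁻¹ 1_{m₁} ⊗ I_{m₃})`. -/
def uhat2 (m₁ m₂ m₃ : ℕ) (t : ℤ → ℤ → Matrix (Fin m₃) (Fin m₃) ℂ) (l₁ l₂ : ℂ) :
    Matrix ((Fin m₁ × Fin m₃) ⊕ (Fin m₁ × Fin m₃)) (Fin m₃) ℂ :=
  vhat2 m₁ m₂ m₃ t l₁ l₂ +
    Complex.I • Matrix.fromRows 0
      (colKronId m₃ (Matrix.mulVec ((calA m₁ - l₁ • 1)⁻¹) (fun _ : Fin m₁ => (1 : ℂ))))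

/-- `K₁₁ = col [(1/2)M₄₂⁽⁰⁾, (1/2)M₄₂⁽⁰⁾+M₄₂⁽¹⁾, …]`. -/
def K11 (m₁ m₂ m₃ : ℕ) (t : ℤ → ℤ → Matrix (Fin m₃) (Fin m₃) ℂ) :
    Matrix (Fin m₁ × Fin m₃) (Fin m₂ × Fin m₃) ℂ :=
  Matrix.of fun y x =>
    ((2 : ℂ)⁻¹ • M42blk m₂ m₃ t 0 +
      ∑ j ∈ Finset.range (y.1 : ℕ), M42blk m₂ m₃ t ((j : ℤ) + 1)) y.2 x

/-- `K₁₂ = [(1/2)M₁₂⁽⁰⁾, (1/2)M₁₂⁽⁰⁾+M₁₂⁽⁻¹⁾, …]`. -/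
def K12 (m₁ m₂ m₃ : ℕ) (t : ℤ → ℤ → Matrix (Fin m₃) (Fin m₃) ℂ) :
    Matrix (Fin m₂ × Fin m₃) (Fin m₁ × Fin m₃) ℂ :=
  Matrix.of fun y x =>
    ((2 : ℂ)⁻¹ • M12blk m₂ m₃ t 0 +
      ∑ j ∈ Finset.range (x.1 : ℕ), M12blk m₂ m₃ t (-((j : ℤ) + 1))) y x.2

/-- `K = [(1/2)M₄₂⁽⁰⁾, (1/2)M₄₂⁽⁰⁾+M₄₂⁽⁻¹⁾, …]`. -/
def Kmat (m₁ m₂ m₃ : ℕ) (t : ℤ → ℤ → Matrix (Fin m₃) (Fin m₃) ℂ) :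
    Matrix (Fin m₃) (Idx m₁ m₂ m₃) ℂ :=
  Matrix.of fun l x =>
    ((2 : ℂ)⁻¹ • M42blk m₂ m₃ t 0 +
      ∑ j ∈ Finset.range (x.1.1 : ℕ), M42blk m₂ m₃ t (-((j : ℤ) + 1))) l (x.1.2, x.2)

/-- `N = col [(1/2)M₁₂⁽⁰⁾, (1/2)M₁₂⁽⁰⁾+M₁₂⁽¹⁾, …]`. -/
def Nmat (m₁ m₂ m₃ : ℕ) (t : ℤ → ℤ → Matrix (Fin m₃) (Fin m₃) ℂ) :
    Matrix (Idx m₁ m₂ m₃) (Fin m₃) ℂ :=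
  Matrix.of fun x l =>
    ((2 : ℂ)⁻¹ • M12blk m₂ m₃ t 0 +
      ∑ j ∈ Finset.range (x.1.1 : ℕ), M12blk m₂ m₃ t ((j : ℤ) + 1)) (x.1.2, x.2) l

/-- `diag {(𝒜-zI) ⊗ I_{m₃}, (𝒜-zI) ⊗ I_{m₃}}` (the diagonal blocks `G₁₁`, `G₂₂`). -/
def diagKron (n m₃ : ℕ) (z : ℂ) :
    Matrix ((Fin n × Fin m₃) ⊕ (Fin n × Fin m₃)) ((Fin n × Fin m₃) ⊕ (Fin n × Fin m₃)) ℂ :=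
  Matrix.fromBlocks ((calA n - z • 1) ⊗ₖ (1 : Matrix (Fin m₃) (Fin m₃) ℂ)) 0 0
    ((calA n - z • 1) ⊗ₖ (1 : Matrix (Fin m₃) (Fin m₃) ℂ))

/-- `diag {(𝒜^*-zI) ⊗ I_{m₃}, (𝒜^*-zI) ⊗ I_{m₃}}` (the diagonal blocks `E₁₁`, `E₂₂`). -/
def diagKronH (n m₃ : ℕ) (z : ℂ) :
    Matrix ((Fin n × Fin m₃) ⊕ (Fin n × Fin m₃)) ((Fin n × Fin m₃) ⊕ (Fin n × Fin m₃)) ℂ :=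
  Matrix.fromBlocks (((calA n)ᴴ - z • 1) ⊗ₖ (1 : Matrix (Fin m₃) (Fin m₃) ℂ)) 0 0
    (((calA n)ᴴ - z • 1) ⊗ₖ (1 : Matrix (Fin m₃) (Fin m₃) ℂ))

/-- `𝔄(z) = diag {(𝒜^*-zI) ⊗ I_{m₃}, (𝒜-zI) ⊗ I_{m₃}}`. -/
def frakA (n m₃ : ℕ) (z : ℂ) :
    Matrix ((Fin n × Fin m₃) ⊕ (Fin n × Fin m₃)) ((Fin n × Fin m₃) ⊕ (Fin n × Fin m₃)) ℂ :=
  Matrix.fromBlocks (((calA n)ᴴ - z • 1) ⊗ₖ (1 : Matrix (Fin m₃) (Fin m₃) ℂ)) 0 0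
    ((calA n - z • 1) ⊗ₖ (1 : Matrix (Fin m₃) (Fin m₃) ℂ))

/-- `G₁₂ = i (Π̂₁ Γ₂ - [[ℒ₂ℒ₁^*, 0], [K₁₂, 0]])`. -/
def G12 (m₁ m₂ m₃ : ℕ) (t : ℤ → ℤ → Matrix (Fin m₃) (Fin m₃) ℂ) :
    Matrix ((Fin m₂ × Fin m₃) ⊕ (Fin m₂ × Fin m₃)) ((Fin m₁ × Fin m₃) ⊕ (Fin m₁ × Fin m₃)) ℂ :=
  Complex.I • (Pihat1 m₁ m₂ m₃ t * Gamma2 m₁ m₂ m₃ t -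
    Matrix.fromBlocks (Lp m₂ m₃ * (Lp m₁ m₃)ᴴ) 0 (K12 m₁ m₂ m₃ t) 0)

/-- `G₂₁ = i (Π̂₂ Γ₁ - [[ℒ₁ℒ₂^*, 0], [K₁₁, 0]])`. -/
def G21 (m₁ m₂ m₃ : ℕ) (t : ℤ → ℤ → Matrix (Fin m₃) (Fin m₃) ℂ) :
    Matrix ((Fin m₁ × Fin m₃) ⊕ (Fin m₁ × Fin m₃)) ((Fin m₂ × Fin m₃) ⊕ (Fin m₂ × Fin m₃)) ℂ :=
  Complex.I • (Pihat2 m₁ m₂ m₃ t * Gamma1 m₁ m₂ m₃ t -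
    Matrix.fromBlocks (Lp m₁ m₃ * (Lp m₂ m₃)ᴴ) 0 (K11 m₁ m₂ m₃ t) 0)

/-- `G(λ) = [[G₁₁(λ₂), G₁₂], [G₂₁, G₂₂(λ₁)]]`. -/
def Gmat (m₁ m₂ m₃ : ℕ) (t : ℤ → ℤ → Matrix (Fin m₃) (Fin m₃) ℂ) (l₁ l₂ : ℂ) :
    Matrix ((((Fin m₂ × Fin m₃) ⊕ (Fin m₂ × Fin m₃))) ⊕ (((Fin m₁ × Fin m₃) ⊕ (Fin m₁ × Fin m₃))))
      ((((Fin m₂ × Fin m₃) ⊕ (Fin m₂ × Fin m₃))) ⊕ (((Fin m₁ × Fin m₃) ⊕ (Fin m₁ × Fin m₃)))) ℂ :=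
  Matrix.fromBlocks (diagKron m₂ m₃ l₂) (G12 m₁ m₂ m₃ t) (G21 m₁ m₂ m₃ t) (diagKron m₁ m₃ l₁)

/-- `E₁₂ = -i (Π̂₁ Γ₂ - [[0, 0], [K₁₂, ℒ₂ℒ₁^*]])`. -/
def E12m (m₁ m₂ m₃ : ℕ) (t : ℤ → ℤ → Matrix (Fin m₃) (Fin m₃) ℂ) :
    Matrix ((Fin m₂ × Fin m₃) ⊕ (Fin m₂ × Fin m₃)) ((Fin m₁ × Fin m₃) ⊕ (Fin m₁ × Fin m₃)) ℂ :=
  (-Complex.I) • (Pihat1 m₁ m₂ m₃ t * Gamma2 m₁ m₂ m₃ t -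
    Matrix.fromBlocks 0 0 (K12 m₁ m₂ m₃ t) (Lp m₂ m₃ * (Lp m₁ m₃)ᴴ))

/-- `E₂₁ = -i (Π̂₂ Γ₁ - [[0, 0], [K₁₁, ℒ₁ℒ₂^*]])`. -/
def E21m (m₁ m₂ m₃ : ℕ) (t : ℤ → ℤ → Matrix (Fin m₃) (Fin m₃) ℂ) :
    Matrix ((Fin m₁ × Fin m₃) ⊕ (Fin m₁ × Fin m₃)) ((Fin m₂ × Fin m₃) ⊕ (Fin m₂ × Fin m₃)) ℂ :=
  (-Complex.I) • (Pihat2 m₁ m₂ m₃ t * Gamma1 m₁ m₂ m₃ t -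
    Matrix.fromBlocks 0 0 (K11 m₁ m₂ m₃ t) (Lp m₁ m₃ * (Lp m₂ m₃)ᴴ))

/-- `E(μ) = [[E₁₁(μ₂), E₁₂], [E₂₁, E₂₂(μ₁)]]`. -/
def Emat (m₁ m₂ m₃ : ℕ) (t : ℤ → ℤ → Matrix (Fin m₃) (Fin m₃) ℂ) (mu₁ mu₂ : ℂ) :
    Matrix ((((Fin m₂ × Fin m₃) ⊕ (Fin m₂ × Fin m₃))) ⊕ (((Fin m₁ × Fin m₃) ⊕ (Fin m₁ × Fin m₃))))
      ((((Fin m₂ × Fin m₃) ⊕ (Fin m₂ × Fin m₃))) ⊕ (((Fin m₁ × Fin m₃) ⊕ (Fin m₁ × Fin m₃)))) ℂ :=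
  Matrix.fromBlocks (diagKronH m₂ m₃ mu₂) (E12m m₁ m₂ m₃ t) (E21m m₁ m₂ m₃ t) (diagKronH m₁ m₃ mu₁)

/-- `θ(λ) = i (I_{m₃} + K R (A₁-λ₁I)⁻¹ (A₂-λ₂I)⁻¹ ℒ)`. -/
def theta (m₁ m₂ m₃ : ℕ) (t : ℤ → ℤ → Matrix (Fin m₃) (Fin m₃) ℂ) (l₁ l₂ : ℂ) :
    Matrix (Fin m₃) (Fin m₃) ℂ :=
  Complex.I • (1 + Kmat m₁ m₂ m₃ t * (Tmat m₁ m₂ m₃ t)⁻¹ *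
    (A1 m₁ m₂ m₃ - l₁ • 1)⁻¹ * (A2 m₁ m₂ m₃ - l₂ • 1)⁻¹ * Lmat m₁ m₂ m₃)

/-- `ϑ(μ) = -i (I_{m₃} + ℒ^* (A₁^*-μ₁I)⁻¹ (A₂^*-μ₂I)⁻¹ R N)`. -/
def vartheta (m₁ m₂ m₃ : ℕ) (t : ℤ → ℤ → Matrix (Fin m₃) (Fin m₃) ℂ) (mu₁ mu₂ : ℂ) :
    Matrix (Fin m₃) (Fin m₃) ℂ :=
  (-Complex.I) • (1 + (Lmat m₁ m₂ m₃)ᴴ * ((A1 m₁ m₂ m₃)ᴴ - mu₁ • 1)⁻¹ *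
    ((A2 m₁ m₂ m₃)ᴴ - mu₂ • 1)⁻¹ * (Tmat m₁ m₂ m₃ t)⁻¹ * Nmat m₁ m₂ m₃ t)

/-- The exchange (anti-diagonal) matrix `U_n = {δ_{n-i-k+1}}`. -/
def Up (n : ℕ) : Matrix (Fin n) (Fin n) ℂ :=
  Matrix.of fun i k => if (i : ℕ) + (k : ℕ) + 1 = n then 1 else 0

/-- `U = U₁ ⊗ U₂ ⊗ U₃`. -/
def Umat (m₁ m₂ m₃ : ℕ) : Matrix (Idx m₁ m₂ m₃) (Idx m₁ m₂ m₃) ℂ :=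
  (Up m₁ ⊗ₖ Up m₂) ⊗ₖ Up m₃

/-- `Ũ_k = [[0, -(U_k ⊗ U₃)], [U_k ⊗ U₃, 0]]`. -/
def Utilde (n m₃ : ℕ) :
    Matrix ((Fin n × Fin m₃) ⊕ (Fin n × Fin m₃)) ((Fin n × Fin m₃) ⊕ (Fin n × Fin m₃)) ℂ :=
  Matrix.fromBlocks 0 (-(Up n ⊗ₖ Up m₃)) (Up n ⊗ₖ Up m₃) 0

/-- The DSTU property: `U₃ t_j^{(r)} U₃ = (t_j^{(r)})ᵀ` for all blocks. -/
def DSTU (m₃ : ℕ) (t : ℤ → ℤ → Matrix (Fin m₃) (Fin m₃) ℂ) : Prop :=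
  ∀ r j : ℤ, Up m₃ * t r j * Up m₃ = (t r j)ᵀ

/-- `q(μ) = ((μ₁-i/2)/(μ₁+i/2))^{m₁} ((μ₂-i/2)/(μ₂+i/2))^{m₂}`. -/
def qfun (m₁ m₂ : ℕ) (mu₁ mu₂ : ℂ) : ℂ :=
  ((mu₁ - Complex.I / 2) / (mu₁ + Complex.I / 2)) ^ m₁ *
    ((mu₂ - Complex.I / 2) / (mu₂ + Complex.I / 2)) ^ m₂

theorem aux_toep (τ : ℤ → ℂ) (x y : ℕ) :
    (2⁻¹ * τ ((x : ℤ) - y) + ∑ j ∈ Finset.range x, τ ((j : ℤ) - y)) +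
    (2⁻¹ * τ ((x : ℤ) - y) + ∑ k ∈ Finset.range y, τ ((x : ℤ) - k)) =
    (2⁻¹ * τ 0 + ∑ s ∈ Finset.range x, τ ((s : ℤ) + 1)) +
    (2⁻¹ * τ 0 + ∑ s ∈ Finset.range y, τ (-((s : ℤ) + 1))) := by
  induction y with
  | zero =>
    have h1 := Finset.sum_range_succ (fun j : ℕ => τ (j : ℤ)) x
    have h2 := Finset.sum_range_succ' (fun j : ℕ => τ (j : ℤ)) x
    simp only [Nat.cast_zero, sub_zero, Finset.range_zero, Finset.sum_empty] at *
    push_cast at h2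
    linear_combination h2 - h1
  | succ y ih =>
    have h1 := Finset.sum_range_succ (fun j : ℕ => τ ((j : ℤ) - (y + 1))) x
    have h2 := Finset.sum_range_succ' (fun j : ℕ => τ ((j : ℤ) - (y + 1))) x
    push_cast at h2
    have h3 : ∀ j : ℕ, (j : ℤ) + 1 - (y + 1) = j - y := fun j => by ring
    have h4 : (0 : ℤ) - (y + 1) = -(y + 1) := by ring
    simp only [h3, h4] at h2
    rw [Finset.sum_range_succ, Finset.sum_range_succ]
    push_cast
    linear_combination ih - h1 + h2

theorem aux_ent (x j : ℕ) (c : ℂ) : aEnt ((x : ℤ) - j) * c =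
    Complex.I * ((if j = x then 2⁻¹ * c else 0) + if j < x then c else 0) := by
  unfold aEnt
  rcases lt_trichotomy j x with h | h | h
  · have h1 : ¬ ((x : ℤ) - j < 0) := by omega
    have h2 : ¬ ((x : ℤ) - j = 0) := by omega
    have h3 : j ≠ x := by omega
    simp [h1, h2, h3, h]
  · subst h
    simp
    ring
  · have h1 : ((x : ℤ) - j < 0) := by omega
    have h3 : j ≠ x := by omega
    have h4 : ¬ j < x := by omega
    simp only [h1, h3, h4, if_true, if_false]
    simp

theorem aux_row (n : ℕ) (x : Fin n) (f : ℕ → ℂ) :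
    ∑ j : Fin n, calA n x j * f j =
      Complex.I * (2⁻¹ * f x + ∑ j ∈ Finset.range (x : ℕ), f j) := by
  have hx := x.2
  simp only [calA, Matrix.of_apply, aux_ent]
  rw [← Finset.mul_sum]
  rw [Fin.sum_univ_eq_sum_range
    (fun j : ℕ => (if j = (x : ℕ) then 2⁻¹ * f j else 0) + if j < (x : ℕ) then f j else 0) n]
  rw [Finset.sum_add_distrib, Finset.sum_ite_eq', ← Finset.sum_filter]
  have : (Finset.range n).filter (fun j => j < (x : ℕ)) = Finset.range x := by
    ext j
    simp
    omega
  rw [this]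
  simp

theorem aux_conj (n : ℕ) (x y : Fin n) : star (calA n x y) = - calA n x y := by
  simp only [calA, aEnt, Matrix.of_apply]
  split_ifs <;> simp [neg_div]

theorem aux_inv {n k : Type*} [Fintype n] [DecidableEq n] [Fintype k]
    (T A B : Matrix n n ℂ) (P : Matrix n k ℂ) (Q : Matrix k n ℂ) (hT : IsUnit T)
    (h : A * T - T * B = Complex.I • (P * Q)) :
    T⁻¹ * A - B * T⁻¹ = Complex.I • ((T⁻¹ * P) * (Q * T⁻¹)) := by
  have hd := (Matrix.isUnit_iff_isUnit_det T).1 hT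
  have e : Complex.I • ((T⁻¹ * P) * (Q * T⁻¹)) = T⁻¹ * (Complex.I • (P * Q)) * T⁻¹ := by
    simp only [Matrix.mul_smul, Matrix.smul_mul, Matrix.mul_assoc]
  rw [e, ← h, Matrix.mul_sub, Matrix.sub_mul]
  congr 1
  · rw [← Matrix.mul_assoc, Matrix.mul_assoc _ T, Matrix.mul_nonsing_inv _ hd, Matrix.mul_one]
  · rw [← Matrix.mul_assoc, Matrix.nonsing_inv_mul _ hd, Matrix.one_mul]

theorem aux_id1 (m₁ m₂ m₃ : ℕ) (t : ℤ → ℤ → Matrix (Fin m₃) (Fin m₃) ℂ) :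
    A1 m₁ m₂ m₃ * Tmat m₁ m₂ m₃ t - Tmat m₁ m₂ m₃ t * (A1 m₁ m₂ m₃)ᴴ =
      Complex.I • (Pi1 m₁ m₂ m₃ t * Pihat1 m₁ m₂ m₃ t) := by
  ext ⟨⟨x1, x2⟩, x3⟩ ⟨⟨y1, y2⟩, y3⟩
  have hA : (A1 m₁ m₂ m₃ * Tmat m₁ m₂ m₃ t) ((x1, x2), x3) ((y1, y2), y3) =
      ∑ j : Fin m₁, calA m₁ x1 j * t (((j : ℕ) : ℤ) - (y1 : ℕ)) ((x2 : ℕ) - (y2 : ℕ)) x3 y3 := by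
    simp [Matrix.mul_apply, A1, Tmat, Fintype.sum_prod_type, Matrix.one_apply]
  have hB : (Tmat m₁ m₂ m₃ t * (A1 m₁ m₂ m₃)ᴴ) ((x1, x2), x3) ((y1, y2), y3) =
      - ∑ j : Fin m₁, calA m₁ y1 j * t ((x1 : ℕ) - ((j : ℕ) : ℤ)) ((x2 : ℕ) - (y2 : ℕ)) x3 y3 := by
    have hc := aux_conj m₁
    simp only [RCLike.star_def] at hc
    simp [Matrix.mul_apply, A1, Tmat, Fintype.sum_prod_type, Matrix.one_apply, hc, mul_comm,
      apply_ite]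
  rw [Matrix.sub_apply, hA, hB,
    aux_row m₁ x1 (fun j => t ((j : ℤ) - (y1 : ℕ)) ((x2 : ℕ) - (y2 : ℕ)) x3 y3),
    aux_row m₁ y1 (fun j => t ((x1 : ℕ) - (j : ℤ)) ((x2 : ℕ) - (y2 : ℕ)) x3 y3),
    sub_neg_eq_add, ← mul_add, aux_toep (fun r => t r ((x2 : ℕ) - (y2 : ℕ)) x3 y3)]
  simp [Pi1, Pihat1, Matrix.fromCols_mul_fromRows, Matrix.mul_apply, M11, M21, M31, M41, calT,
    Fintype.sum_prod_type, Matrix.sum_apply, ite_and, apply_ite]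

theorem aux_id2 (m₁ m₂ m₃ : ℕ) (t : ℤ → ℤ → Matrix (Fin m₃) (Fin m₃) ℂ) :
    A2 m₁ m₂ m₃ * Tmat m₁ m₂ m₃ t - Tmat m₁ m₂ m₃ t * (A2 m₁ m₂ m₃)ᴴ =
      Complex.I • (Pi2 m₁ m₂ m₃ t * Pihat2 m₁ m₂ m₃ t) := by
  ext ⟨⟨x1, x2⟩, x3⟩ ⟨⟨y1, y2⟩, y3⟩
  have hA : (A2 m₁ m₂ m₃ * Tmat m₁ m₂ m₃ t) ((x1, x2), x3) ((y1, y2), y3) =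
      ∑ j : Fin m₂, calA m₂ x2 j * t ((x1 : ℕ) - (y1 : ℕ)) (((j : ℕ) : ℤ) - (y2 : ℕ)) x3 y3 := by
    simp [Matrix.mul_apply, A2, Tmat, Fintype.sum_prod_type, Matrix.one_apply]
  have hB : (Tmat m₁ m₂ m₃ t * (A2 m₁ m₂ m₃)ᴴ) ((x1, x2), x3) ((y1, y2), y3) =
      - ∑ j : Fin m₂, calA m₂ y2 j * t ((x1 : ℕ) - (y1 : ℕ)) ((x2 : ℕ) - ((j : ℕ) : ℤ)) x3 y3 := by
    have hc := aux_conj m₂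
    simp only [RCLike.star_def] at hc
    simp [Matrix.mul_apply, A2, Tmat, Fintype.sum_prod_type, Matrix.one_apply, hc, mul_comm,
      apply_ite]
  rw [Matrix.sub_apply, hA, hB,
    aux_row m₂ x2 (fun j => t ((x1 : ℕ) - (y1 : ℕ)) ((j : ℤ) - (y2 : ℕ)) x3 y3),
    aux_row m₂ y2 (fun j => t ((x1 : ℕ) - (y1 : ℕ)) ((x2 : ℕ) - (j : ℤ)) x3 y3),
    sub_neg_eq_add, ← mul_add, aux_toep (fun r => t ((x1 : ℕ) - (y1 : ℕ)) r x3 y3)]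
  simp [Pi2, Pihat2, Matrix.fromCols_mul_fromRows, Matrix.mul_apply, M12, M22, M32, M42, M12blk,
    M42blk, Fintype.sum_prod_type, Matrix.sum_apply, ite_and, apply_ite]

/-- If `T` is invertible then `R A_p - A_p^* R = i Γ_p Γ̂_p` for `p = 1, 2`. -/
theorem statement7 (m₁ m₂ m₃ : ℕ) (hm₁ : 2 ≤ m₁) (hm₂ : 2 ≤ m₂) (hm₃ : 2 ≤ m₃)
    (t : ℤ → ℤ → Matrix (Fin m₃) (Fin m₃) ℂ) (hT : IsUnit (Tmat m₁ m₂ m₃ t)) :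
    (Tmat m₁ m₂ m₃ t)⁻¹ * A1 m₁ m₂ m₃ - (A1 m₁ m₂ m₃)ᴴ * (Tmat m₁ m₂ m₃ t)⁻¹ =
      Complex.I • (Gamma1 m₁ m₂ m₃ t * Gammahat1 m₁ m₂ m₃ t) ∧
    (Tmat m₁ m₂ m₃ t)⁻¹ * A2 m₁ m₂ m₃ - (A2 m₁ m₂ m₃)ᴴ * (Tmat m₁ m₂ m₃ t)⁻¹ =
      Complex.I • (Gamma2 m₁ m₂ m₃ t * Gammahat2 m₁ m₂ m₃ t) := by
  exact ⟨aux_inv _ _ _ _ _ hT (aux_id1 m₁ m₂ m₃ t), aux_inv _ _ _ _ _ hT (aux_id2 m₁ m₂ m₃ t)⟩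

end TBT
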